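/- Let n ≥ 2, let λ : Fin n → ℝ with λ_i > 0 for all i, and let θ, α ∈ ℝⁿ satisfy Σ_i α_i θ_i ≠ 0 and λ₀²·θ₁·α₀ ≠ λ₁²·θ₀·α₁ (indices 0 and 1). Then there exists β ∈ ℝⁿ with β ≠ α, β_i = α_i for all i ≥ 2, Σ_i β_i θ_i = Σ_i α_i θ_i, and Σ_i λ_i² β_i² = Σ_i λ_i² α_i². In particular, the vectors μ_α = (λ_i α_i / Σ_j α_j θ_j)_i and μ_β = (λ_i β_i / Σ_j β_j θ_j)_i are distinct but have equal Euclidean norms. -/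

import Mathlib

/-- A line in the coordinate plane `(i, j)` that lies in the hyperplane `∑ k, x k * θ k = const` and
is not tangent at `α` to the ellipsoid `∑ k, w k * x k ^ 2 = const` meets it in a second point. -/
theorem exists_ne_sum_mul_eq_sum_mul_sq_eq {ι : Type*} [Fintype ι] (w θ α : ι → ℝ) {i j : ι}
    (hij : i ≠ j) (hi : 0 < w i) (hj : 0 < w j) (htan : w i * θ j * α i ≠ w j * θ i * α j) :
    ∃ β : ι → ℝ, β ≠ α ∧ (∀ k, k ≠ i ∧ k ≠ j → β k = α k) ∧
      (∑ k, β k * θ k = ∑ k, α k * θ k) ∧ ∑ k, w k * β k ^ 2 = ∑ k, w k * α k ^ 2 := by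
  classical
  have hθ : θ i ≠ 0 ∨ θ j ≠ 0 := by
    by_contra! h
    simp [h.1, h.2] at htan
  have hD : 0 < w i * θ j ^ 2 + w j * θ i ^ 2 := by
    rcases hθ with h | h <;> positivity
  obtain ⟨t, ht, htD⟩ : ∃ t : ℝ, t ≠ 0 ∧ t * (w i * θ j ^ 2 + w j * θ i ^ 2) =
      -2 * (w i * θ j * α i - w j * θ i * α j) :=
    ⟨-2 * (w i * θ j * α i - w j * θ i * α j) / (w i * θ j ^ 2 + w j * θ i ^ 2),
      div_ne_zero (mul_ne_zero (by norm_num) (sub_ne_zero.2 htan)) hD.ne',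
      div_mul_cancel₀ _ hD.ne'⟩
  let β := Function.update (Function.update α i (α i + t * θ j)) j (α j - t * θ i)
  have hβi : β i = α i + t * θ j := by simp [β, hij]
  have hβj : β j = α j - t * θ i := by simp [β]
  have hβ : ∀ k, k ≠ i ∧ k ≠ j → β k = α k := fun k hk => by simp [β, hk.1, hk.2]
  refine ⟨β, fun h => ?_, hβ, ?_, ?_⟩
  · rw [h] at hβi hβj
    rcases hθ with h0 | h0
    · exact mul_ne_zero ht h0 (by linarith)
    · exact mul_ne_zero ht h0 (by linarith)
  · rw [← sub_eq_zero, ← Finset.sum_sub_distrib,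
      Fintype.sum_eq_add i j hij (fun k hk => by rw [hβ k hk, sub_self]), hβi, hβj]
    ring
  · rw [← sub_eq_zero, ← Finset.sum_sub_distrib,
      Fintype.sum_eq_add i j hij (fun k hk => by rw [hβ k hk, sub_self]), hβi, hβj]
    linear_combination t * htD


/-- Finite-dimensional form of Lemma 2: given positive `λ_i`, and vectors `θ, α ∈ ℝⁿ`
with `Σ αᵢθᵢ ≠ 0` and the non-tangency condition `λ₀²θ₁α₀ ≠ λ₁²θ₀α₁`, there is
`β ≠ α` agreeing with `α` on all coordinates `i ≥ 2`, lying on the same hyperplane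
`Σ βᵢθᵢ = Σ αᵢθᵢ` and ellipsoid `Σ λᵢ²βᵢ² = Σ λᵢ²αᵢ²`; in particular the embedding
vectors `μ_α = (λᵢαᵢ/αᵀθ)ᵢ` and `μ_β = (λᵢβᵢ/βᵀθ)ᵢ` are distinct with equal norms. -/
theorem second_density_same_embedding_norm_findim
    (n : ℕ) (hn : 2 ≤ n) (lam θ α : Fin n → ℝ)
    (hlam : ∀ i, 0 < lam i)
    (hS : ∑ i, α i * θ i ≠ 0)
    (htan : (lam ⟨0, by omega⟩) ^ 2 * θ ⟨1, by omega⟩ * α ⟨0, by omega⟩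
          ≠ (lam ⟨1, by omega⟩) ^ 2 * θ ⟨0, by omega⟩ * α ⟨1, by omega⟩) :
    ∃ β : Fin n → ℝ, β ≠ α ∧ (∀ i : Fin n, 2 ≤ (i : ℕ) → β i = α i) ∧
      (∑ i, β i * θ i = ∑ i, α i * θ i) ∧
      (∑ i, (lam i) ^ 2 * (β i) ^ 2 = ∑ i, (lam i) ^ 2 * (α i) ^ 2) ∧
      (fun i => lam i * β i / ∑ j, β j * θ j) ≠ (fun i => lam i * α i / ∑ j, α j * θ j) ∧
      (∑ i, (lam i * β i / ∑ j, β j * θ j) ^ 2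
        = ∑ i, (lam i * α i / ∑ j, α j * θ j) ^ 2) := by
  obtain ⟨β, hne, hβ, hsum, hsq⟩ :=
    exists_ne_sum_mul_eq_sum_mul_sq_eq (fun i => lam i ^ 2) θ α
      (i := ⟨0, by omega⟩) (j := ⟨1, by omega⟩) (by simp)
      (pow_pos (hlam _) 2) (pow_pos (hlam _) 2) htan
  refine ⟨β, hne, fun i hi => hβ i ?_, hsum, hsq, fun h => hne ?_, ?_⟩
  · constructor <;> rintro rfl <;> simp at hi
  · funext i
    have hi := congrFun h i
    simp only [hsum] at hi
    exact mul_left_cancel₀ (hlam i).ne' ((div_left_inj' hS).1 hi)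
  · simp only [hsum, div_pow, mul_pow, ← Finset.sum_div, hsq]
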